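/- Let X be a rearrangement invariant quasi-Banach space on ℝ and let 0 < q < ∞. If the upper Boyd index satisfies q_X < q, then the operator H_{(q,∞)} is bounded from X to X; that is, there exists a constant c > 0 such that ‖H_{(q,∞)} f‖_X ≤ c ‖f‖_X for all f ∈ X. -/

import Mathlib

open MeasureTheory Set Filter Topology ENNReal

noncomputable section

/-- The decreasing rearrangement of an `ℝ≥0∞`-valued function with respect to a measure `μ`:
`g⁎(s) = sup {t : μ {x | g x > t} > s}`. -/
def distRearr {α : Type*} [MeasurableSpace α] (μ : Measure α) (g : α → ℝ≥0∞) (s : ℝ) : ℝ≥0∞ :=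
  sSup {t : ℝ≥0∞ | ENNReal.ofReal s < μ {x | t < g x}}

/-- Decreasing rearrangement of an `ℝ≥0∞`-valued function on `ℝ` (Lebesgue measure). -/
def rearrE (g : ℝ → ℝ≥0∞) : ℝ → ℝ≥0∞ := distRearr (volume : Measure ℝ) g

/-- Decreasing rearrangement `f^*` of a real-valued function on `ℝ`:
`f^*(s) = sup {t ≥ 0 : volume {x : |f x| > t} > s}`. -/
def rearr (f : ℝ → ℝ) : ℝ → ℝ≥0∞ := rearrE fun x => ENNReal.ofReal |f x|

/-- The dilation operator `D_a f (t) = f (a t)`. -/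
def dil (a : ℝ) (f : ℝ → ℝ) : ℝ → ℝ := fun t => f (a * t)

/-- The dilation operator on `ℝ≥0∞`-valued functions. -/
def dilE (a : ℝ) (g : ℝ → ℝ≥0∞) : ℝ → ℝ≥0∞ := fun t => g (a * t)

/-- A rearrangement invariant quasi-Banach function space on `ℝ` (with Lebesgue measure).
The quasi-norm `N` is defined on all `ℝ≥0∞`-valued functions (a signed function `f`
is measured via `|f|`, embedded into `ℝ≥0∞`; this is harmless since the quasi-norm of a
rearrangement invariant space depends only on `|f|`).  Membership of a signed function
`f` in the space means `f` is measurable with `N (|f|) < ∞`. -/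
structure RIQB where
  /-- the quasi-norm -/
  N : (ℝ → ℝ≥0∞) → ℝ≥0∞
  /-- the quasi-triangle inequality constant -/
  C : ℝ
  one_le_C : 1 ≤ C
  /-- homogeneity of the quasi-norm -/
  norm_smul : ∀ (c : ℝ≥0∞) (g : ℝ → ℝ≥0∞), N (fun x => c * g x) = c * N g
  /-- the quasi-triangle inequality -/
  quasi_triangle : ∀ g h : ℝ → ℝ≥0∞, AEMeasurable g volume → AEMeasurable h volume →
    N (fun x => g x + h x) ≤ ENNReal.ofReal C * (N g + N h)
  /-- definiteness (functions are identified a.e.) -/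
  definite : ∀ g : ℝ → ℝ≥0∞, AEMeasurable g volume → (N g = 0 ↔ g =ᵐ[volume] 0)
  /-- property (i): if `h^* ≤ g^*` then `‖h‖ ≤ ‖g‖` -/
  rearr_mono : ∀ g h : ℝ → ℝ≥0∞, AEMeasurable g volume → AEMeasurable h volume →
    (∀ s : ℝ, 0 < s → rearrE h s ≤ rearrE g s) → N h ≤ N g
  /-- property (ii): simple functions with support of finite measure belong to the space -/
  simple_mem : ∀ f : MeasureTheory.SimpleFunc ℝ ℝ,
    volume (Function.support (f : ℝ → ℝ)) < ∞ → N (fun x => ENNReal.ofReal |f x|) < ∞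
  /-- property (iii) or (iii′) -/
  fatou :
    (∀ g : ℕ → ℝ → ℝ≥0∞, (∀ n, AEMeasurable (g n) volume ∧ N (g n) < ∞) →
      (∀ x, Antitone fun n => g n x) → (∀ x, Tendsto (fun n => g n x) atTop (𝓝 0)) →
      Tendsto (fun n => N (g n)) atTop (𝓝 0)) ∨
    (∀ (g : ℕ → ℝ → ℝ≥0∞) (h : ℝ → ℝ≥0∞),
      (∀ n, AEMeasurable (g n) volume ∧ N (g n) < ∞) →
      (∀ x, Monotone fun n => g n x) → (∀ x, Tendsto (fun n => g n x) atTop (𝓝 (h x))) →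
      (⨆ n, N (g n)) < ∞ → N h = ⨆ n, N (g n))
  /-- completeness of the quasi-norm -/
  complete : ∀ f : ℕ → ℝ → ℝ,
    (∀ n, AEMeasurable (f n) volume ∧ N (fun x => ENNReal.ofReal |f n x|) < ∞) →
    (∀ ε : ℝ, 0 < ε → ∃ M : ℕ, ∀ m ≥ M, ∀ n ≥ M,
      N (fun x => ENNReal.ofReal |f m x - f n x|) < ENNReal.ofReal ε) →
    ∃ g : ℝ → ℝ, AEMeasurable g volume ∧ N (fun x => ENNReal.ofReal |g x|) < ∞ ∧
      Tendsto (fun n => N (fun x => ENNReal.ofReal |f n x - g x|)) atTop (𝓝 0)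

/-- The quasi-norm of a signed function. -/
def RIQB.Nr (X : RIQB) (f : ℝ → ℝ) : ℝ≥0∞ := X.N fun x => ENNReal.ofReal |f x|

/-- Membership in the space. -/
def RIQB.mem (X : RIQB) (f : ℝ → ℝ) : Prop := AEMeasurable f volume ∧ X.Nr f < ∞

/-- The lower Boyd index of a quasi-norm functional:
`sup {p > 0 : ∃ c > 0, ∀ 0 < a < 1, ∀ f ∈ X, ‖D_a f‖ ≤ c a^(-1/p) ‖f‖}`. -/
def lowerBoydOf (N : (ℝ → ℝ) → ℝ≥0∞) : ℝ≥0∞ :=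
  ⨆ p ∈ {p : ℝ | 0 < p ∧ ∃ c : ℝ, 0 < c ∧ ∀ a : ℝ, 0 < a → a < 1 →
      ∀ f : ℝ → ℝ, AEMeasurable f volume → N f < ∞ →
        N (dil a f) ≤ ENNReal.ofReal (c * a ^ (-(1/p))) * N f},
    ENNReal.ofReal p

/-- The upper Boyd index of a quasi-norm functional:
`inf {q > 0 : ∃ c > 0, ∀ a > 1, ∀ f ∈ X, ‖D_a f‖ ≤ c a^(-1/q) ‖f‖}`. -/
def upperBoydOf (N : (ℝ → ℝ) → ℝ≥0∞) : ℝ≥0∞ :=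
  ⨅ q ∈ {q : ℝ | 0 < q ∧ ∃ c : ℝ, 0 < c ∧ ∀ a : ℝ, 1 < a →
      ∀ f : ℝ → ℝ, AEMeasurable f volume → N f < ∞ →
        N (dil a f) ≤ ENNReal.ofReal (c * a ^ (-(1/q))) * N f},
    ENNReal.ofReal q

/-- The lower Boyd index `p_X`. -/
def lowerBoyd (X : RIQB) : ℝ≥0∞ := lowerBoydOf X.Nr

/-- The upper Boyd index `q_X`. -/
def upperBoyd (X : RIQB) : ℝ≥0∞ := upperBoydOf X.Nr

/-- The Hardy operator `H^{(p,r)}` acting on a nonnegative (`ℝ≥0∞`-valued) function: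
`t^{-1/p} ((r/p) ∫₀ᵗ g(s)^r s^{r/p-1} ds)^{1/r}` for `t > 0`, and `0` for `t ≤ 0`. -/
def hardyUE (p r : ℝ) (g : ℝ → ℝ≥0∞) : ℝ → ℝ≥0∞ := fun t =>
  if 0 < t then
    ENNReal.ofReal t ^ (-(1/p)) *
      (ENNReal.ofReal (r/p) *
        ∫⁻ s in Ioo (0:ℝ) t, g s ^ r * ENNReal.ofReal (s ^ (r/p - 1))) ^ (1/r)
  else 0

/-- The Hardy operator `H^{(p,r)} f (t) = t^{-1/p} ((r/p) ∫₀ᵗ f^*(s)^r s^{r/p-1} ds)^{1/r}`. -/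
def hardyU (p r : ℝ) (f : ℝ → ℝ) : ℝ → ℝ≥0∞ := hardyUE p r (rearr f)

/-- The Hardy operator `H^{(p,∞)} f (t) = sup_{0<s<t} (s/t)^{1/p} f^*(s)`. -/
def hardyUSup (p : ℝ) (f : ℝ → ℝ) : ℝ → ℝ≥0∞ := fun t =>
  if 0 < t then ⨆ s ∈ Ioo (0:ℝ) t, ENNReal.ofReal ((s/t) ^ (1/p)) * rearr f s else 0

/-- The Hardy operator
`H_{(q,r)} f (t) = t^{-1/q} ((r/q) ∫_t^∞ f^*(s)^r s^{r/q-1} ds)^{1/r}` for finite `q`. -/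
def hardyL (q r : ℝ) (f : ℝ → ℝ) : ℝ → ℝ≥0∞ := fun t =>
  if 0 < t then
    ENNReal.ofReal t ^ (-(1/q)) *
      (ENNReal.ofReal (r/q) *
        ∫⁻ s in Ioi t, rearr f s ^ r * ENNReal.ofReal (s ^ (r/q - 1))) ^ (1/r)
  else 0

/-- The Hardy operator `H_{(∞,r)} f (t) = (∫_t^∞ f^*(s)^r s⁻¹ ds)^{1/r}`. -/
def hardyLInf (r : ℝ) (f : ℝ → ℝ) : ℝ → ℝ≥0∞ := fun t =>
  if 0 < t then (∫⁻ s in Ioi t, rearr f s ^ r * ENNReal.ofReal s⁻¹) ^ (1/r) else 0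

/-- The Hardy operator `H_{(q,r)}` for `0 < q ≤ ∞`, `0 < r < ∞`. -/
def hardyLG (q : ℝ≥0∞) (r : ℝ) (f : ℝ → ℝ) : ℝ → ℝ≥0∞ :=
  if q = ∞ then hardyLInf r f else hardyL q.toReal r f

/-- The Hardy operator `H_{(q,∞)} f (t) = sup_{s>t} (s/t)^{1/q} f^*(s)`. -/
def hardyLSup (q : ℝ) (f : ℝ → ℝ) : ℝ → ℝ≥0∞ := fun t =>
  if 0 < t then ⨆ s ∈ Ioi t, ENNReal.ofReal ((s/t) ^ (1/q)) * rearr f s else 0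

/-- The Hardy operator `H^{(p,r)}` for `0 < p < ∞`, `0 < r ≤ ∞`. -/
def hardyUG (p : ℝ) (r : ℝ≥0∞) (f : ℝ → ℝ) : ℝ → ℝ≥0∞ :=
  if r = ∞ then hardyUSup p f else hardyU p r.toReal f

/-- The Hardy operator `H_{(q,s)}` for `0 < q ≤ ∞`, `0 < s ≤ ∞`
(with `H_{(∞,∞)} f = f^*`). -/
def hardyLGG (q s : ℝ≥0∞) (f : ℝ → ℝ) : ℝ → ℝ≥0∞ :=
  if q = ∞ then
    (if s = ∞ then (fun t => if 0 < t then rearr f t else 0) else hardyLInf s.toReal f)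
  else
    (if s = ∞ then hardyLSup q.toReal f else hardyL q.toReal s.toReal f)

/-- The Lorentz quasi-norm `‖f‖_{p,r}` for `0 < p ≤ ∞`, `0 < r ≤ ∞`. -/
def lorentz (p r : ℝ≥0∞) (f : ℝ → ℝ) : ℝ≥0∞ :=
  if p = ∞ then
    (if r = ∞ then essSup (fun x => ENNReal.ofReal |f x|) volume
     else (∫⁻ t in Ioi (0:ℝ), rearr f t ^ r.toReal * ENNReal.ofReal t⁻¹) ^ (1/r.toReal))
  else
    (if r = ∞ then ⨆ t ∈ Ioi (0:ℝ), ENNReal.ofReal t ^ (1/p.toReal) * rearr f t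
     else (∫⁻ t in Ioi (0:ℝ),
        (ENNReal.ofReal t ^ (1/p.toReal) * rearr f t) ^ r.toReal * ENNReal.ofReal t⁻¹) ^
          (1/r.toReal))

/-- The weak-`L_p` (Lorentz `(p,∞)`) quasi-norm of an `ℝ≥0∞`-valued function on `ℝ`:
`sup_{t>0} t^{1/p} g^*(t)`. -/
def lorentzWE (p : ℝ) (g : ℝ → ℝ≥0∞) : ℝ≥0∞ :=
  ⨆ t ∈ Ioi (0:ℝ), ENNReal.ofReal t ^ (1/p) * rearrE g t

lemma rearrE_mono_of_ae_le {g h : ℝ → ℝ≥0∞} (hgh : h ≤ᵐ[volume] g) (s : ℝ) :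
    rearrE h s ≤ rearrE g s := by
  refine sSup_le_sSup fun t ht => lt_of_lt_of_le ht (measure_mono_ae ?_)
  filter_upwards [hgh] with x hx
  exact fun hxt : t < h x => hxt.trans_le hx

lemma rearrE_antitone (g : ℝ → ℝ≥0∞) : Antitone (rearrE g) := fun _ _ hst =>
  sSup_le_sSup fun _ ht => (ENNReal.ofReal_le_ofReal hst).trans_lt ht

/-- The rearrangement of `g`, extended by zero to the half-line `(-∞, 0]`, is dominated by the
rearrangement of `g`. -/
lemma rearrE_indicator_rearrE_le (g : ℝ → ℝ≥0∞) (s : ℝ) :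
    rearrE ((Ioi 0).indicator (rearrE g)) s ≤ rearrE g s := by
  refine sSup_le_sSup fun t ht => ?_
  simp only [mem_ofPred_eq] at ht ⊢
  refine ht.trans_le ?_
  have key : ∀ x, t < (Ioi (0 : ℝ)).indicator (rearrE g) x →
      0 < x ∧ ENNReal.ofReal x < volume {y | t < g y} := by
    intro x hx
    by_cases hx0 : x ∈ Ioi (0 : ℝ)
    · rw [indicator_of_mem hx0] at hx
      obtain ⟨u, hu, htu⟩ := lt_sSup_iff.1 hx
      exact ⟨hx0, lt_of_lt_of_le hu (measure_mono fun y hy => htu.trans hy)⟩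
    · rw [indicator_of_notMem hx0] at hx
      exact absurd hx (by simp)
  rcases eq_or_ne (volume {y | t < g y}) ∞ with htop | hfin
  · rw [htop]; exact le_top
  · calc volume {x | t < (Ioi (0 : ℝ)).indicator (rearrE g) x}
        ≤ volume (Ioo 0 (volume {y | t < g y}).toReal) := by
          refine measure_mono fun x hx => ?_
          obtain ⟨h0, h1⟩ := key x hx
          exact ⟨h0, (ENNReal.ofReal_lt_iff_lt_toReal h0.le hfin).1 h1⟩
      _ = volume {y | t < g y} := by
          rw [Real.volume_Ioo, sub_zero, ENNReal.ofReal_toReal hfin]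

namespace RIQB

variable (X : RIQB)

lemma N_mono {g h : ℝ → ℝ≥0∞} (hg : AEMeasurable g volume) (hh : AEMeasurable h volume)
    (hgh : h ≤ᵐ[volume] g) : X.N h ≤ X.N g :=
  X.rearr_mono g h hg hh fun s _ => rearrE_mono_of_ae_le hgh s

lemma N_zero : X.N (fun _ => 0) = 0 := by
  simpa using X.norm_smul 0 (fun _ => 0)

/-- Functions of finite quasi-norm have finite rearrangement on `(0, ∞)`. -/
lemma rearrE_ne_top {g : ℝ → ℝ≥0∞} (hg : AEMeasurable g volume) (hN : X.N g < ∞)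
    {s : ℝ} (hs : 0 < s) : rearrE g s ≠ ∞ := by
  intro htop
  set e : ℝ → ℝ≥0∞ := (Ioo (0 : ℝ) s).indicator fun _ => 1 with he
  have hem : AEMeasurable e volume := (measurable_const.indicator measurableSet_Ioo).aemeasurable
  have hle : X.N (fun x => ∞ * e x) ≤ X.N g := by
    refine X.rearr_mono _ _ hg (hem.const_mul _) fun u _ => sSup_le fun t ht => ?_
    have hus : u < s := by
      by_contra hsu
      refine absurd (lt_of_lt_of_le ht ?_) (lt_irrefl (ENNReal.ofReal u))
      calc volume {x | t < ∞ * e x} ≤ volume (Ioo 0 s) := by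
            refine measure_mono fun x hx => ?_
            by_contra hxs
            simp [he, indicator_of_notMem hxs] at hx
        _ ≤ ENNReal.ofReal u := by
            rw [Real.volume_Ioo, sub_zero]
            exact ENNReal.ofReal_le_ofReal (not_lt.1 hsu)
    exact le_top.trans (htop.ge.trans (rearrE_antitone g hus.le))
  rw [X.norm_smul] at hle
  have hne : X.N e ≠ 0 := by
    intro h0
    have h1 := (X.definite e hem).1 h0
    rw [he, indicator_ae_eq_zero] at h1
    have h2 : volume (Ioo (0 : ℝ) s) = 0 := by
      simpa [Function.support_const (one_ne_zero : (1 : ℝ≥0∞) ≠ 0)] using h1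
    rw [Real.volume_Ioo, sub_zero, ENNReal.ofReal_eq_zero] at h2
    linarith
  rw [ENNReal.top_mul hne] at hle
  exact absurd hN (not_lt.2 hle)

lemma one_le_ofReal_C : 1 ≤ ENNReal.ofReal X.C := ENNReal.one_le_ofReal.2 X.one_le_C

/-- Iterated quasi-triangle inequality for a geometrically small family. -/
lemma N_sum_le {g : ℕ → ℝ → ℝ≥0∞} (hg : ∀ k, AEMeasurable (g k) volume) {A : ℝ≥0∞}
    (hA : ∀ k, X.N (g k) ≤ A * ((2 * ENNReal.ofReal X.C)⁻¹) ^ k) (n m : ℕ) :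
    X.N (fun x => ∑ k ∈ Finset.range n, g (m + k) x) ≤
      2 * ENNReal.ofReal X.C * A * ((2 * ENNReal.ofReal X.C)⁻¹) ^ m := by
  induction n generalizing m with
  | zero => simp [X.N_zero]
  | succ n ih =>
    have hfun : (fun x => ∑ k ∈ Finset.range (n + 1), g (m + k) x) =
        fun x => g m x + ∑ k ∈ Finset.range n, g (m + 1 + k) x := by
      funext x
      rw [Finset.sum_range_succ', add_comm]
      simp only [add_zero, add_assoc, add_comm 1]
    have hD0 : 2 * ENNReal.ofReal X.C ≠ 0 :=
      mul_ne_zero two_ne_zero (zero_lt_one.trans_le X.one_le_ofReal_C).ne'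
    have hDt : 2 * ENNReal.ofReal X.C ≠ ∞ := ENNReal.mul_ne_top (by simp) ENNReal.ofReal_ne_top
    rw [hfun]
    calc _ ≤ ENNReal.ofReal X.C * (X.N (g m) +
            X.N (fun x => ∑ k ∈ Finset.range n, g (m + 1 + k) x)) :=
          X.quasi_triangle _ _ (hg m) (Finset.aemeasurable_fun_sum _ fun k _ => hg _)
      _ ≤ ENNReal.ofReal X.C * (A * ((2 * ENNReal.ofReal X.C)⁻¹) ^ m +
            2 * ENNReal.ofReal X.C * A * ((2 * ENNReal.ofReal X.C)⁻¹) ^ (m + 1)) := by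
          gcongr
          · exact hA m
          · exact ih (m + 1)
      _ = ENNReal.ofReal X.C * (A * ((2 * ENNReal.ofReal X.C)⁻¹) ^ m +
            (2 * ENNReal.ofReal X.C * (2 * ENNReal.ofReal X.C)⁻¹) * A *
              ((2 * ENNReal.ofReal X.C)⁻¹) ^ m) := by ring
      _ = _ := by rw [ENNReal.mul_inv_cancel hD0 hDt]; ring

/-- The supremum of a geometrically small sequence of nonnegative functions is controlled by
the first term of the geometric bound. -/
lemma N_iSup_le {G : ℕ → ℝ → ℝ} (hG : ∀ k, Measurable (G k)) (hG0 : ∀ k x, 0 ≤ G k x)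
    {A : ℝ≥0∞} (hAt : A ≠ ∞)
    (hA : ∀ k, X.Nr (G k) ≤ A * ((2 * ENNReal.ofReal X.C)⁻¹) ^ k) :
    X.N (fun x => ⨆ k, ENNReal.ofReal (G k x)) ≤
      ENNReal.ofReal X.C * (2 * ENNReal.ofReal X.C * A) := by
  set D : ℝ≥0∞ := 2 * ENNReal.ofReal X.C with hD
  have hDt : D ≠ ∞ := ENNReal.mul_ne_top (by simp) ENNReal.ofReal_ne_top
  have hBt : D * A ≠ ∞ := ENNReal.mul_ne_top hDt hAt
  have hD1 : D⁻¹ < 1 := by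
    refine ENNReal.inv_lt_one.2 (lt_of_lt_of_le (b := (2 : ℝ≥0∞)) (by norm_num) ?_)
    exact le_mul_of_one_le_right' X.one_le_ofReal_C
  set g : ℕ → ℝ → ℝ≥0∞ := fun k x => ENNReal.ofReal (G k x) with hg
  have hgm : ∀ k, AEMeasurable (g k) volume := fun k => (hG k).ennreal_ofReal.aemeasurable
  have hgN : ∀ k, X.N (g k) ≤ A * D⁻¹ ^ k := fun k => by
    simpa only [Nr, abs_of_nonneg (hG0 k _)] using hA k
  set S : ℕ → ℝ → ℝ := fun n x => ∑ k ∈ Finset.range n, G k x with hS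
  have hSm : ∀ n, Measurable (S n) := fun n => Finset.measurable_fun_sum _ fun k _ => hG k
  have hS_mono : ∀ x, Monotone fun n => S n x := fun x => monotone_nat_of_le_succ fun n => by
    simp only [hS, Finset.sum_range_succ]
    linarith [hG0 n x]
  have htail : ∀ n d, X.N (fun x => ENNReal.ofReal |S (n + d) x - S n x|) ≤ D * A * D⁻¹ ^ n := by
    intro n d
    convert X.N_sum_le hgm hgN d n using 3 with x
    rw [abs_of_nonneg (sub_nonneg.2 (hS_mono x (Nat.le_add_right n d)))]
    simp only [hS, hg]
    rw [Finset.sum_range_add, add_sub_cancel_left,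
      ENNReal.ofReal_sum_of_nonneg fun k _ => hG0 _ _]
  have hSN : ∀ n, X.N (fun x => ENNReal.ofReal |S n x|) ≤ D * A := fun n => by
    simpa [hS] using htail 0 n
  have hlim : Tendsto (fun n => D * A * D⁻¹ ^ n) atTop (𝓝 0) := by
    simpa using ENNReal.Tendsto.const_mul
      (ENNReal.tendsto_pow_atTop_nhds_zero_of_lt_one hD1) (Or.inr hBt)
  obtain ⟨h, hhm, -, hh⟩ := X.complete S
    (fun n => ⟨(hSm n).aemeasurable, (hSN n).trans_lt hBt.lt_top⟩) fun ε hε => by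
      obtain ⟨M, hM⟩ := eventually_atTop.1 (hlim.eventually_lt_const (ENNReal.ofReal_pos.2 hε))
      refine ⟨M, fun m hm n hn => ?_⟩
      rcases le_total n m with hnm | hnm
      · obtain ⟨d, rfl⟩ := Nat.exists_eq_add_of_le hnm
        exact (htail n d).trans_lt (hM n hn)
      · obtain ⟨d, rfl⟩ := Nat.exists_eq_add_of_le hnm
        simp_rw [abs_sub_comm (S m _)]
        exact (htail m d).trans_lt (hM m hm)
  have hle : ∀ n, ∀ᵐ x, S n x ≤ h x := by
    intro n
    have hm : AEMeasurable (fun x => ENNReal.ofReal (S n x - h x)) volume :=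
      ((hSm n).aemeasurable.sub hhm).ennreal_ofReal
    have hzero : X.N (fun x => ENNReal.ofReal (S n x - h x)) = 0 := by
      refine le_antisymm (ge_of_tendsto hh ?_) zero_le
      filter_upwards [eventually_ge_atTop n] with m hnm
      refine X.N_mono ?_ hm (Eventually.of_forall fun x => ENNReal.ofReal_le_ofReal ?_)
      · simpa only [Real.norm_eq_abs] using
          ((hSm m).aemeasurable.fun_sub hhm).norm.ennreal_ofReal
      · exact (sub_le_sub_right (hS_mono x hnm) _).trans (le_abs_self _)
    filter_upwards [(X.definite _ hm).1 hzero] with x hx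
    simpa using hx
  have hhm' : AEMeasurable (fun x => ENNReal.ofReal |h x|) volume := by
    simpa only [Real.norm_eq_abs] using hhm.norm.ennreal_ofReal
  have hsup : X.N (fun x => ⨆ k, g k x) ≤ X.N (fun x => ENNReal.ofReal |h x|) := by
    refine X.N_mono hhm' (AEMeasurable.iSup hgm) ?_
    filter_upwards [ae_all_iff.2 hle] with x hx
    refine iSup_le fun k => ENNReal.ofReal_le_ofReal (le_trans ?_ ((hx (k + 1)).trans
      (le_abs_self _)))
    exact Finset.single_le_sum (f := fun k => G k x) (fun i _ => hG0 i x)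
      (Finset.self_mem_range_succ k)
  have hbound : ∀ n, X.N (fun x => ENNReal.ofReal |h x|) ≤
      ENNReal.ofReal X.C * (D * A + X.N (fun x => ENNReal.ofReal |S n x - h x|)) := by
    intro n
    have hm1 : AEMeasurable (fun x => ENNReal.ofReal |S n x|) volume := by
      simpa only [Real.norm_eq_abs] using (hSm n).aemeasurable.norm.ennreal_ofReal
    have hm2 : AEMeasurable (fun x => ENNReal.ofReal |S n x - h x|) volume := by
      simpa only [Real.norm_eq_abs] using ((hSm n).aemeasurable.fun_sub hhm).norm.ennreal_ofReal
    calc _ ≤ X.N (fun x => ENNReal.ofReal |S n x| + ENNReal.ofReal |S n x - h x|) := by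
          refine X.N_mono (hm1.add hm2) hhm' (Eventually.of_forall fun x => ?_)
          dsimp only
          rw [← ENNReal.ofReal_add (abs_nonneg _) (abs_nonneg _)]
          refine ENNReal.ofReal_le_ofReal ?_
          simpa using abs_sub (S n x) (S n x - h x)
      _ ≤ _ := (X.quasi_triangle _ _ hm1 hm2).trans (by gcongr; exact hSN n)
  have hlim' : Tendsto (fun n => ENNReal.ofReal X.C *
      (D * A + X.N (fun x => ENNReal.ofReal |S n x - h x|))) atTop
      (𝓝 (ENNReal.ofReal X.C * (D * A))) := by
    simpa using ENNReal.Tendsto.const_mul (tendsto_const_nhds.add hh)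
      (Or.inr ENNReal.ofReal_ne_top)
  exact hsup.trans (ge_of_tendsto' hlim' hbound)

end RIQB

lemma aemeasurable_hardyLSup {q : ℝ} (hq : 0 < q) (f : ℝ → ℝ) :
    AEMeasurable (hardyLSup q f) volume := by
  have hanti : AntitoneOn
      (fun t => ⨆ s ∈ Ioi t, ENNReal.ofReal ((s/t) ^ (1/q)) * rearr f s) (Ioi 0) := by
    intro t ht t' ht' htt'
    refine iSup₂_le fun s hs => le_trans ?_ (le_iSup₂ (f := fun s (_ : s ∈ Ioi t) =>
      ENNReal.ofReal ((s/t) ^ (1/q)) * rearr f s) s (lt_of_le_of_lt htt' hs))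
    have hs0 : 0 < s := lt_trans (mem_Ioi.1 ht') (mem_Ioi.1 hs)
    have ht0 : 0 < t := ht
    have : 0 < t' := ht'
    gcongr
  have := (aemeasurable_indicator_iff measurableSet_Ioi).2
    (aemeasurable_restrict_of_antitoneOn (μ := volume) measurableSet_Ioi hanti)
  exact this

/-- Splitting the supremum defining `hardyLSup` along a geometric progression. -/
lemma hardyLSup_le_iSup {q b : ℝ} (hq : 0 < q) (hb : 1 < b) (f : ℝ → ℝ) {t : ℝ} (ht : 0 < t) :
    hardyLSup q f t ≤
      ⨆ k : ℕ, ENNReal.ofReal ((b ^ (k + 1)) ^ (1/q)) * rearr f (b ^ k * t) := by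
  rw [hardyLSup, if_pos ht]
  refine iSup₂_le fun s hs => ?_
  obtain ⟨k, hk, hk'⟩ := exists_nat_pow_near ((one_le_div ht).2 (le_of_lt hs)) hb
  refine le_iSup_of_le k (mul_le_mul' (ENNReal.ofReal_le_ofReal ?_) (rearrE_antitone _ ?_))
  · have : 0 < s := ht.trans hs
    gcongr
  · exact (le_div_iff₀ ht).1 hk

/-- **Theorem 2 (iv).** If `q_X < q` (with `0 < q < ∞`) then `H_{(q,∞)}` is bounded on `X`. -/
theorem hardyLSup_bounded_of_upperBoyd_lt (X : RIQB) (q : ℝ) (hq : 0 < q)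
    (hqX : upperBoyd X < ENNReal.ofReal q) :
    ∃ c : ℝ, 0 < c ∧ ∀ f : ℝ → ℝ, X.mem f →
      X.N (hardyLSup q f) ≤ ENNReal.ofReal c * X.Nr f := by
  obtain ⟨p, ⟨hp, c, hc, hdil⟩, hpq⟩ : ∃ p : ℝ, (0 < p ∧ ∃ c : ℝ, 0 < c ∧ ∀ a : ℝ, 1 < a →
      ∀ f : ℝ → ℝ, AEMeasurable f volume → X.Nr f < ∞ →
        X.Nr (dil a f) ≤ ENNReal.ofReal (c * a ^ (-(1/p))) * X.Nr f) ∧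
      ENNReal.ofReal p < ENNReal.ofReal q := by
    simpa only [upperBoyd, upperBoydOf, iInf_lt_iff, exists_prop, mem_ofPred_eq] using hqX
  replace hpq : p < q := (ENNReal.ofReal_lt_ofReal_iff hq).1 hpq
  have hδ : 0 < 1/p - 1/q := sub_pos.2 (one_div_lt_one_div_of_lt hp hpq)
  have hC := X.one_le_C
  set b : ℝ := (2 * X.C) ^ (1/p - 1/q)⁻¹ with hb_def
  have hb : 1 < b := Real.one_lt_rpow (by linarith) (inv_pos.2 hδ)
  have hb0 : 0 < b := by linarith
  have hbδ : b ^ (1/p - 1/q) = 2 * X.C := Real.rpow_inv_rpow (by linarith) hδ.ne'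
  have hbk : ∀ k : ℕ, (b ^ (k + 1)) ^ (1/q) * (b ^ k) ^ (-(1/p)) =
      b ^ (1/q) * ((2 * X.C)⁻¹) ^ k := by
    intro k
    rw [← hbδ, ← Real.rpow_neg hb0.le, ← Real.rpow_natCast, ← Real.rpow_natCast,
      ← Real.rpow_natCast, ← Real.rpow_mul hb0.le, ← Real.rpow_mul hb0.le, ← Real.rpow_mul hb0.le,
      ← Real.rpow_add hb0, ← Real.rpow_add hb0]
    push_cast
    congr 1
    ring
  have hD : (ENNReal.ofReal (2 * X.C)⁻¹) = (2 * ENNReal.ofReal X.C)⁻¹ := by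
    rw [ENNReal.ofReal_inv_of_pos (by linarith), ENNReal.ofReal_mul zero_le_two,
      ENNReal.ofReal_ofNat]
  refine ⟨X.C * (2 * X.C * ((c + 1) * b ^ (1/q))), by positivity, fun f hf => ?_⟩
  have hfm : AEMeasurable (fun x => ENNReal.ofReal |f x|) volume := by
    simpa only [Real.norm_eq_abs] using hf.1.norm.ennreal_ofReal
  set F : ℝ → ℝ≥0∞ := (Ioi (0 : ℝ)).indicator (rearr f) with hF
  have hFm : Measurable F := (rearrE_antitone _).measurable.indicator measurableSet_Ioi
  have hFt : ∀ x, F x ≠ ∞ := by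
    intro x
    by_cases hx : x ∈ Ioi (0 : ℝ)
    · rw [hF, indicator_of_mem hx]
      exact X.rearrE_ne_top hfm hf.2 hx
    · rw [hF, indicator_of_notMem hx]
      exact ENNReal.zero_ne_top
  have hφm : Measurable fun x => (F x).toReal := hFm.ennreal_toReal
  have hφN : X.Nr (fun x => (F x).toReal) ≤ X.Nr f := by
    refine X.rearr_mono _ _ hfm ?_ fun s _ => ?_
    · simpa only [Real.norm_eq_abs] using hφm.aemeasurable.norm.ennreal_ofReal
    · simp_rw [abs_of_nonneg ENNReal.toReal_nonneg, ENNReal.ofReal_toReal (hFt _)]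
      exact rearrE_indicator_rearrE_le _ s
  have hφdil : ∀ k : ℕ, X.Nr (dil (b ^ k) fun x => (F x).toReal) ≤
      ENNReal.ofReal ((c + 1) * (b ^ k) ^ (-(1/p))) * X.Nr f := by
    intro k
    rcases Nat.eq_zero_or_pos k with rfl | hk
    · have h1 : 1 ≤ ENNReal.ofReal ((c + 1) * (b ^ 0) ^ (-(1/p))) := by
        rw [ENNReal.one_le_ofReal]
        simp [hc.le]
      have hd : dil (b ^ 0) (fun x => (F x).toReal) = fun x => (F x).toReal := by
        funext x
        simp [dil]
      rw [hd]
      exact hφN.trans (le_mul_of_one_le_left' h1)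
    · refine (hdil _ (one_lt_pow₀ hb hk.ne') _ hφm.aemeasurable (hφN.trans_lt hf.2)).trans ?_
      gcongr
      linarith
  set G : ℕ → ℝ → ℝ := fun k x => (b ^ (k + 1)) ^ (1/q) * (F (b ^ k * x)).toReal with hG
  have hGN : ∀ k, X.Nr (G k) ≤ ENNReal.ofReal ((c + 1) * b ^ (1/q)) * X.Nr f *
      ((2 * ENNReal.ofReal X.C)⁻¹) ^ k := by
    intro k
    have hpos : 0 ≤ (b ^ (k + 1)) ^ (1/q) := by positivity
    calc X.Nr (G k) = ENNReal.ofReal ((b ^ (k + 1)) ^ (1/q)) *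
          X.Nr (dil (b ^ k) fun x => (F x).toReal) := by
          rw [RIQB.Nr, RIQB.Nr, ← X.norm_smul]
          simp only [hG, dil, abs_mul, abs_of_nonneg hpos, ENNReal.ofReal_mul hpos]
      _ ≤ ENNReal.ofReal ((b ^ (k + 1)) ^ (1/q)) *
          (ENNReal.ofReal ((c + 1) * (b ^ k) ^ (-(1/p))) * X.Nr f) := by
          gcongr
          exact hφdil k
      _ = ENNReal.ofReal ((c + 1) * b ^ (1/q) * ((2 * X.C)⁻¹) ^ k) * X.Nr f := by
          rw [← mul_assoc, ← ENNReal.ofReal_mul hpos, mul_assoc (c + 1), ← hbk k]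
          congr 2
          ring
      _ = _ := by
          rw [ENNReal.ofReal_mul (by positivity), ENNReal.ofReal_pow (by positivity), hD]
          ring
  have hGm : ∀ k, Measurable (G k) := fun k =>
    (hφm.comp (measurable_const_mul (b ^ k))).const_mul _
  have hmain := X.N_iSup_le hGm (fun k x => by positivity)
    (ENNReal.mul_ne_top ENNReal.ofReal_ne_top hf.2.ne) hGN
  have hdom : hardyLSup q f ≤ fun x => ⨆ k, ENNReal.ofReal (G k x) := by
    intro t
    by_cases ht : 0 < t
    · refine (hardyLSup_le_iSup hq hb f ht).trans (iSup_mono fun k => ?_)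
      have hbt : b ^ k * t ∈ Ioi (0 : ℝ) := mem_Ioi.2 (by positivity)
      have hFk : F (b ^ k * t) = rearr f (b ^ k * t) := by rw [hF, indicator_of_mem hbt]
      simp only [hG]
      rw [ENNReal.ofReal_mul (by positivity), ENNReal.ofReal_toReal (hFt _), hFk]
    · simp [hardyLSup, ht]
  refine (X.N_mono (AEMeasurable.iSup fun k => (hGm k).ennreal_ofReal.aemeasurable)
    (aemeasurable_hardyLSup hq f) (Eventually.of_forall hdom)).trans (hmain.trans_eq ?_)
  rw [ENNReal.ofReal_mul (p := X.C) (by linarith),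
    ENNReal.ofReal_mul (p := 2 * X.C) (by linarith), ENNReal.ofReal_mul zero_le_two, ENNReal.ofReal_ofNat]
  ring

end
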